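/- Let N = kn and let m = p·binomial(N,2) be an integer with m ≥ N-1 and m = Ω(binomial(N,2)/log n). If G is a uniformly random connected graph on N labeled vertices with m edges and T is a uniformly random spanning tree of G, then the probability that T is k-splittable is at least C_k · n^{(1-k)/2} · p · e^{-(2+o(1))/p}, where C_k depends only on k. -/

import Mathlib

open SimpleGraph Finset Filter

attribute [local instance] Classical.propDecidable

/-- A spanning tree `T` is `k`-splittable into pieces of size `n` if some `k-1` of its
edges can be removed so that each connected component of the result has `n` vertices. -/
def IsSplittable {V : Type*} [Fintype V] (T : SimpleGraph V) (k n : ℕ) : Prop :=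
  ∃ F : Finset (Sym2 V), ↑F ⊆ T.edgeSet ∧ F.card = k - 1 ∧
    ∀ c : (T.deleteEdges ↑F).ConnectedComponent, c.supp.ncard = n

/-- The number of spanning trees of `G`. -/
noncomputable def numSpanningTrees {V : Type*} [Fintype V] (G : SimpleGraph V) : ℕ :=
  Set.ncard {T : SimpleGraph V | T ≤ G ∧ T.IsTree}

/-- The number of `k`-splittable spanning trees of `G`. -/
noncomputable def numSplittableSpanningTrees {V : Type*} [Fintype V]
    (G : SimpleGraph V) (k n : ℕ) : ℕ :=
  Set.ncard {T : SimpleGraph V | T ≤ G ∧ T.IsTree ∧ IsSplittable T k n}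

/-- The probability that a uniform random spanning tree of a uniformly random connected
graph with `m` edges on the vertex set `Fin (k*n)` is `k`-splittable: the average over
all connected graphs `G` with `m` edges of `τₖ(G)/τ(G)`. -/
noncomputable def gnmSplitProb (k n m : ℕ) : ℝ :=
  (∑ G ∈ Finset.univ.filter
      (fun G : SimpleGraph (Fin (k * n)) => G.Connected ∧ G.edgeFinset.card = m),
      (numSplittableSpanningTrees G k n : ℝ) / (numSpanningTrees G : ℝ)) /
    ((Finset.univ.filter
      (fun G : SimpleGraph (Fin (k * n)) => G.Connected ∧ G.edgeFinset.card = m)).card : ℝ)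

/-- A symmetrized form of the **Cauchy–Binet formula**: summing over all maps of the row indices
counts every set of columns once for each of its orderings. -/
theorem Matrix.factorial_mul_det_mul {ι E R : Type*} [Fintype ι] [DecidableEq ι] [Fintype E]
    [CommRing R] (A : Matrix ι E R) (C : Matrix E ι R) :
    ((Fintype.card ι).factorial : R) * (A * C).det =
      ∑ f : ι → E, (A.submatrix id f).det * (C.submatrix f id).det := by
  have expand : (A * C).det = ∑ f : ι → E, (∏ i, A i (f i)) * (C.submatrix f id).det := by
    have h := (Matrix.detRowAlternating (n := ι) (R := R)).toMultilinearMap.map_sum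
      (fun i e => A i e • C e)
    have h1 : (fun i => ∑ e, A i e • C e) = A * C := by
      ext i j
      simp [Matrix.mul_apply]
    rw [h1] at h
    refine h.trans (Finset.sum_congr rfl fun f _ => ?_)
    exact (MultilinearMap.map_smul_univ _ (fun i => A i (f i)) (fun i => C (f i))).trans rfl
  have perm (σ : Equiv.Perm ι) : (A * C).det = ∑ f : ι → E,
      ((Equiv.Perm.sign σ : ℤ) : R) * (∏ i, A i (f (σ i))) * (C.submatrix f id).det := by
    rw [expand, ← (Equiv.arrowCongr σ (Equiv.refl E)).symm.sum_comp]
    refine Finset.sum_congr rfl fun f _ => ?_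
    have : (C.submatrix f id).submatrix σ id =
        C.submatrix ((Equiv.arrowCongr σ (Equiv.refl E)).symm f) id := by
      ext i j
      simp [Equiv.arrowCongr]
    rw [← this, Matrix.det_permute]
    simp only [Equiv.arrowCongr, Equiv.coe_fn_symm_mk, Equiv.refl_symm, Equiv.coe_refl,
      Function.id_comp, Function.comp_apply]
    ring
  have hsum : ∑ _σ : Equiv.Perm ι, (A * C).det =
      ((Fintype.card ι).factorial : R) * (A * C).det := by
    simp [Fintype.card_perm]
  rw [← hsum, Finset.sum_congr rfl fun σ _ => perm σ, Finset.sum_comm]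
  refine Finset.sum_congr rfl fun f _ => ?_
  rw [← Finset.sum_mul]
  congr 1
  rw [← Matrix.det_transpose (A.submatrix id f), Matrix.det_apply']
  simp

section MatrixTree

variable {V : Type*} [Fintype V]

/-- The incidence matrix of the complete graph with the row of `r` removed; every edge is
oriented by an arbitrary choice. -/
noncomputable def reducedIncMatrix (r : V) : Matrix {v : V // v ≠ r} (Sym2 V) ℤ :=
  fun v e => (if e.out.1 = v then 1 else 0) - (if e.out.2 = v then 1 else 0)

theorem sum_mul_reducedIncMatrix {r : V} (X : V → ℤ) (hX : X r = 0) (e : Sym2 V) :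
    ∑ w : {v : V // v ≠ r}, X w * reducedIncMatrix r w e = X e.out.1 - X e.out.2 := by
  have key (a : V) : ∑ w : {v : V // v ≠ r}, X w * (if a = w then 1 else 0) = X a := by
    have h : ∑ w : {v : V // v ≠ r}, X w * (if a = w then 1 else 0) =
        ∑ w ∈ univ.filter (· ≠ r), X w * (if a = w then 1 else 0) :=
      (Finset.sum_subtype (p := (· ≠ r)) _ (by simp) (fun w => X w * (if a = w then 1 else 0))).symm
    rw [h]
    by_cases ha : a = r
    · subst ha
      rw [hX]
      refine Finset.sum_eq_zero fun w hw => ?_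
      simp [Ne.symm (Finset.mem_filter.1 hw).2]
    · simp [ha]
  simp only [reducedIncMatrix, mul_sub, Finset.sum_sub_distrib, key]

theorem reducedIncMatrix_mk {V : Type*} {r : V} {a b : V} :
    (∀ w, reducedIncMatrix r w s(a, b) = (if a = w then 1 else 0) - (if b = w then 1 else 0)) ∨
      ∀ w, reducedIncMatrix r w s(a, b) = (if b = w then 1 else 0) - (if a = w then 1 else 0) := by
  have h : s((s(a, b) : Sym2 V).out.1, (s(a, b) : Sym2 V).out.2) = s(a, b) := Quot.out_eq _
  rcases Sym2.eq_iff.1 h with ⟨h1, h2⟩ | ⟨h1, h2⟩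
  · left; intro w; simp [reducedIncMatrix, h1, h2]
  · right; intro w; simp [reducedIncMatrix, h1, h2]

theorem isUnit_det_of_isTree {r : V} {T : SimpleGraph V} (hT : T.IsTree)
    {f : {v : V // v ≠ r} → Sym2 V} (hf : Set.range f = T.edgeSet) :
    IsUnit ((reducedIncMatrix r).submatrix id f).det := by
  rw [← Matrix.isUnit_iff_isUnit_det, ← Matrix.mulVec_surjective_iff_isUnit]
  set M := (reducedIncMatrix r).submatrix id f
  let δ : V → ({v : V // v ≠ r} → ℤ) := fun a w => if a = w then 1 else 0
  have hadj (a b : V) (h : T.Adj a b) : δ a - δ b ∈ LinearMap.range M.mulVecLin := by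
    obtain ⟨i, hi⟩ : s(a, b) ∈ Set.range f := hf ▸ h
    have hcol : (fun w => reducedIncMatrix r w s(a, b)) ∈ LinearMap.range M.mulVecLin := by
      refine ⟨Pi.single i 1, ?_⟩
      ext w
      simp [M, hi]
    rcases reducedIncMatrix_mk (r := r) (a := a) (b := b) with h' | h' <;> rw [funext h'] at hcol
    · exact hcol
    · rw [← neg_sub]; exact neg_mem hcol
  have hwalk (a b : V) (p : T.Walk a b) : δ a - δ b ∈ LinearMap.range M.mulVecLin := by
    induction p with
    | nil => simp
    | cons h _ ih => simpa using add_mem (hadj _ _ h) ih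
  have hδ (v : {v : V // v ≠ r}) : Pi.single v 1 ∈ LinearMap.range M.mulVecLin := by
    obtain ⟨p⟩ := hT.connected.preconnected v r
    convert hwalk _ _ p using 1
    ext w
    have : r ≠ w := w.2.symm
    simp [δ, this, Pi.single_apply, Subtype.ext_iff, eq_comm]
  intro y
  have : y = ∑ v, y v • (Pi.single v 1 : {v : V // v ≠ r} → ℤ) := by
    ext w; simp [Pi.single_apply]
  rw [this]
  obtain ⟨x, hx⟩ := sum_mem (S := LinearMap.range M.mulVecLin) (t := univ)
    fun v _ => Submodule.smul_mem _ (y v) (hδ v)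
  exact ⟨x, hx⟩

theorem exists_isTree_of_det_ne_zero {r : V} {f : {v : V // v ≠ r} → Sym2 V}
    (h : ((reducedIncMatrix r).submatrix id f).det ≠ 0) :
    Function.Injective f ∧ ∃ T : SimpleGraph V, T.IsTree ∧ Set.range f = T.edgeSet := by
  have hinj : Function.Injective f := by
    intro i j hij
    by_contra hne
    exact h (Matrix.det_zero_of_column_eq hne fun w => by simp [hij])
  have hdiag (i) : ¬ (f i).IsDiag := by
    intro hd
    refine h (Matrix.det_eq_zero_of_column_eq_zero i fun w => ?_)
    have h1 : s((f i).out.1, (f i).out.2) = f i := Quot.out_eq _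
    rw [← h1, Sym2.mk_isDiag_iff] at hd
    simp [reducedIncMatrix, hd]
  set T := SimpleGraph.fromEdgeSet (Set.range f) with hT
  have hedge : Set.range f = T.edgeSet := by
    rw [hT, SimpleGraph.edgeSet_fromEdgeSet]
    ext e
    simp only [Set.mem_range, Set.mem_sdiff]
    constructor
    · rintro ⟨i, rfl⟩; exact ⟨⟨i, rfl⟩, hdiag i⟩
    · exact fun h => h.1
  refine ⟨hinj, T, SimpleGraph.isTree_iff_connected_and_card.2 ⟨?_, ?_⟩, hedge⟩
  · rw [SimpleGraph.connected_iff_exists_forall_reachable]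
    refine ⟨r, ?_⟩
    by_contra! hcon
    obtain ⟨u, hu⟩ := hcon
    let X : V → ℤ := fun v => if T.Reachable r v then 0 else 1
    have hur : u ≠ r := by rintro rfl; exact hu (SimpleGraph.Reachable.refl _)
    refine h (Matrix.exists_vecMul_eq_zero_iff.1 ⟨fun w => X w, ?_, ?_⟩)
    · intro h0
      have := congrFun h0 ⟨u, hur⟩
      simp [X, hu] at this
    · ext i
      have := sum_mul_reducedIncMatrix (r := r) X (by simp [X]) (f i)
      simp only [Matrix.vecMul, dotProduct, Matrix.submatrix_apply, id, Pi.zero_apply]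
      rw [this]
      have h1 : s((f i).out.1, (f i).out.2) = f i := Quot.out_eq _
      have hadj : T.Adj (f i).out.1 (f i).out.2 := by
        rw [← SimpleGraph.mem_edgeSet, ← hedge, h1]; exact ⟨i, rfl⟩
      have : T.Reachable r (f i).out.1 ↔ T.Reachable r (f i).out.2 :=
        ⟨fun h => h.trans hadj.reachable, fun h => h.trans hadj.symm.reachable⟩
      simp [X, this]
  · rw [← hedge, ← Nat.card_congr (Equiv.ofInjective f hinj), Nat.card_eq_fintype_card,
      Fintype.card_subtype_compl, Fintype.card_subtype_eq, Nat.card_eq_fintype_card]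
    have : 0 < Fintype.card V := Fintype.card_pos_iff.2 ⟨r⟩
    omega

theorem card_enumerations_of_isTree (r : V) {T : SimpleGraph V} (hT : T.IsTree) :
    (univ.filter fun f : {v : V // v ≠ r} → Sym2 V =>
      Function.Injective f ∧ Set.range f = T.edgeSet).card =
      (Fintype.card {v : V // v ≠ r}).factorial := by
  have hc : Fintype.card {v : V // v ≠ r} = Fintype.card T.edgeSet := by
    have h1 := (SimpleGraph.isTree_iff_connected_and_card.1 hT).2
    rw [Nat.card_eq_fintype_card, Nat.card_eq_fintype_card] at h1
    rw [Fintype.card_subtype_compl, Fintype.card_subtype_eq]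
    omega
  rw [← Fintype.card_equiv (Fintype.equivOfCardEq hc), ← Fintype.card_subtype]
  refine Fintype.card_congr
    { toFun := fun f => (Equiv.ofInjective f.1 f.2.1).trans (Equiv.setCongr f.2.2)
      invFun := fun e => ⟨fun i => e i, Subtype.val_injective.comp e.injective, ?_⟩
      left_inv := fun f => by ext; rfl
      right_inv := fun e => by ext; rfl }
  ext x
  constructor
  · rintro ⟨i, rfl⟩; exact (e i).2
  · intro hx; exact ⟨e.symm ⟨x, hx⟩, by simp⟩

/-- **Matrix-tree theorem**: the number of spanning trees is the determinant of the reduced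
Laplacian, written as a product of oriented incidence matrices. -/
theorem det_reducedLaplacian (G : SimpleGraph V) (r : V) :
    (reducedIncMatrix r * Matrix.diagonal (fun e => if e ∈ G.edgeSet then (1 : ℤ) else 0) *
      (reducedIncMatrix r).transpose).det = (numSpanningTrees G : ℤ) := by
  have hpos : ((Fintype.card {v : V // v ≠ r}).factorial : ℤ) ≠ 0 := by
    exact_mod_cast Nat.factorial_ne_zero _
  refine mul_left_cancel₀ hpos ?_
  rw [Matrix.factorial_mul_det_mul]
  have hterm (f : {v : V // v ≠ r} → Sym2 V) :
      ((reducedIncMatrix r * Matrix.diagonal (fun e => if e ∈ G.edgeSet then (1 : ℤ) else 0)).submatrix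
        id f).det * ((reducedIncMatrix r).transpose.submatrix f id).det =
      ∑ T ∈ univ.filter (fun T : SimpleGraph V => T ≤ G ∧ T.IsTree),
        if Function.Injective f ∧ Set.range f = T.edgeSet then 1 else 0 := by
    have h1 : (reducedIncMatrix r * Matrix.diagonal
        (fun e => if e ∈ G.edgeSet then (1 : ℤ) else 0)).submatrix id f =
        Matrix.of fun i j => (if f j ∈ G.edgeSet then (1 : ℤ) else 0) *
          (reducedIncMatrix r).submatrix id f i j := by
      ext i j
      simp [Matrix.mul_diagonal]
    have h2 : (reducedIncMatrix r).transpose.submatrix f id =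
        ((reducedIncMatrix r).submatrix id f).transpose := rfl
    rw [h1, h2, Matrix.det_mul_row, Matrix.det_transpose]
    by_cases hf : ∃ T : SimpleGraph V, T ≤ G ∧ T.IsTree ∧
        Function.Injective f ∧ Set.range f = T.edgeSet
    · obtain ⟨T, hTG, hT, hinj, hr⟩ := hf
      have hu : ((reducedIncMatrix r).submatrix id f).det *
          ((reducedIncMatrix r).submatrix id f).det = 1 :=
        Int.isUnit_mul_self (isUnit_det_of_isTree hT hr)
      have hprod : ∏ j, (if f j ∈ G.edgeSet then (1 : ℤ) else 0) = 1 := by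
        refine Finset.prod_eq_one fun j _ => if_pos ?_
        exact SimpleGraph.edgeSet_subset_edgeSet.2 hTG (hr ▸ ⟨j, rfl⟩)
      rw [hprod, one_mul, hu, Finset.sum_eq_single T]
      · simp [hinj, hr]
      · rintro T' - hne
        rw [if_neg]
        rintro ⟨-, hr'⟩
        exact hne (SimpleGraph.edgeSet_injective (hr'.symm.trans hr))
      · simp [hTG, hT]
    · rw [Finset.sum_eq_zero]
      · by_contra hne
        have hd : ((reducedIncMatrix r).submatrix id f).det ≠ 0 := by
          intro h; simp [h] at hne
        obtain ⟨hinj, T, hT, hr⟩ := exists_isTree_of_det_ne_zero hd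
        refine hf ⟨T, ?_, hT, hinj, hr⟩
        rw [← SimpleGraph.edgeSet_subset_edgeSet, ← hr]
        rintro _ ⟨j, rfl⟩
        by_contra hj
        rw [Finset.prod_eq_zero (Finset.mem_univ j) (if_neg hj)] at hne
        simp at hne
      · intro T hT
        rw [Finset.mem_filter] at hT
        rw [if_neg]
        rintro ⟨hinj, hr⟩
        exact hf ⟨T, hT.2.1, hT.2.2, hinj, hr⟩
  rw [Finset.sum_congr rfl fun f _ => hterm f, Finset.sum_comm]
  have hinner (T : SimpleGraph V) (hT : T ∈ univ.filter fun T : SimpleGraph V => T ≤ G ∧ T.IsTree) :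
      (∑ f : {v : V // v ≠ r} → Sym2 V,
        if Function.Injective f ∧ Set.range f = T.edgeSet then (1 : ℤ) else 0) =
      ((Fintype.card {v : V // v ≠ r}).factorial : ℤ) := by
    rw [← card_enumerations_of_isTree r (Finset.mem_filter.1 hT).2.2, Finset.sum_boole]
  rw [Finset.sum_congr rfl hinner, Finset.sum_const, nsmul_eq_mul, mul_comm, numSpanningTrees,
    Set.ncard_eq_toFinset_card', Set.toFinset_ofPred]

end MatrixTree

/-- The arithmetic-geometric mean inequality for the eigenvalues of a positive semidefinite
matrix. -/
theorem Matrix.PosSemidef.det_le_trace_div_pow {ι : Type*} [Fintype ι] [DecidableEq ι] [Nonempty ι]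
    {A : Matrix ι ι ℝ} (hA : A.PosSemidef) :
    A.det ≤ (A.trace / Fintype.card ι) ^ Fintype.card ι := by
  have hn : (Fintype.card ι : ℝ) ≠ 0 := by exact_mod_cast Fintype.card_ne_zero
  have hev := hA.eigenvalues_nonneg
  have h := Real.geom_mean_le_arith_mean_weighted univ (fun _ => (Fintype.card ι : ℝ)⁻¹)
    hA.isHermitian.eigenvalues (fun _ _ => by positivity) (by simp [hn]) fun i _ => hev i
  have hdet : A.det = ∏ i, hA.isHermitian.eigenvalues i := by
    simpa using hA.isHermitian.det_eq_prod_eigenvalues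
  have htr : A.trace = ∑ i, hA.isHermitian.eigenvalues i := by
    simpa using hA.isHermitian.trace_eq_sum_eigenvalues
  rw [Real.finsetProd_rpow _ _ fun i _ => hev i, ← hdet, ← Finset.mul_sum, ← htr] at h
  calc A.det = (A.det ^ (Fintype.card ι : ℝ)⁻¹) ^ Fintype.card ι :=
        (Real.rpow_inv_natCast_pow hA.det_nonneg Fintype.card_ne_zero).symm
    _ ≤ _ := by
        rw [div_eq_inv_mul]
        exact pow_le_pow_left₀ (Real.rpow_nonneg hA.det_nonneg _) h _

theorem sum_sq_reducedIncMatrix {V : Type*} [Fintype V] (r : V) {e : Sym2 V} (he : ¬ e.IsDiag) :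
    ∑ w, reducedIncMatrix r w e * reducedIncMatrix r w e +
      (∑ w, reducedIncMatrix r w e) * (∑ w, reducedIncMatrix r w e) = 2 := by
  have h1 : s(e.out.1, e.out.2) = e := Quot.out_eq _
  have hne : e.out.1 ≠ e.out.2 := by
    rwa [← h1, Sym2.mk_isDiag_iff] at he
  have hsq := sum_mul_reducedIncMatrix (r := r)
    (fun v => if v = r then 0 else (if e.out.1 = v then 1 else 0) - (if e.out.2 = v then 1 else 0))
    (by simp) e
  have hsum := sum_mul_reducedIncMatrix (r := r) (fun v => if v = r then 0 else 1) (by simp) e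
  have hsq' : ∑ w, reducedIncMatrix r w e * reducedIncMatrix r w e = _ :=
    (Finset.sum_congr rfl fun w _ => by rw [if_neg w.2]; rfl).trans hsq
  have hsum' : ∑ w, reducedIncMatrix r w e = _ :=
    (Finset.sum_congr rfl fun w _ => by rw [if_neg w.2, one_mul]).trans hsum
  rw [hsq', hsum']
  by_cases ha : e.out.1 = r <;> by_cases hb : e.out.2 = r
  · exact absurd (ha.trans hb.symm) hne
  · simp [ha, hb, Ne.symm hb]
  · simp [ha, hb, Ne.symm ha]
  · simp [ha, hb, hne, Ne.symm hne]

theorem trace_reducedLaplacian_mul {V : Type*} [Fintype V] (G : SimpleGraph V) (r : V) :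
    (reducedIncMatrix r * Matrix.diagonal (fun e => if e ∈ G.edgeSet then (1 : ℤ) else 0) *
      (reducedIncMatrix r).transpose * (1 + Matrix.of fun _ _ => 1)).trace =
      2 * (G.edgeFinset.card : ℤ) := by
  set d : Sym2 V → ℤ := fun e => if e ∈ G.edgeSet then 1 else 0 with hd
  have h1 : (reducedIncMatrix r * Matrix.diagonal d *
      (reducedIncMatrix r).transpose * (1 + Matrix.of fun _ _ => 1)).trace =
      ∑ e, d e * (∑ w, reducedIncMatrix r w e * reducedIncMatrix r w e +
      (∑ w, reducedIncMatrix r w e) * (∑ w, reducedIncMatrix r w e)) := by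
    have hent (w w') : (reducedIncMatrix r * Matrix.diagonal d * (reducedIncMatrix r).transpose) w w' =
        ∑ e, reducedIncMatrix r w e * d e * reducedIncMatrix r w' e := by
      rw [Matrix.mul_apply]
      simp only [Matrix.mul_diagonal, Matrix.transpose_apply]
    generalize reducedIncMatrix r * Matrix.diagonal d * (reducedIncMatrix r).transpose = L at hent
    simp only [mul_add, mul_one, Matrix.trace_add, Finset.sum_add_distrib]
    congr 1
    · simp only [Matrix.trace, Matrix.diag_apply, hent, Finset.mul_sum]
      rw [Finset.sum_comm]
      exact Finset.sum_congr rfl fun e _ => Finset.sum_congr rfl fun w _ => by ring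
    · simp only [Matrix.trace, Matrix.diag_apply, Matrix.mul_apply, hent, Finset.mul_sum,
        Finset.sum_mul, Matrix.of_apply, mul_one]
      rw [Finset.sum_congr rfl fun _ _ => Finset.sum_comm, Finset.sum_comm]
      exact Finset.sum_congr rfl fun e _ => (Finset.sum_comm).trans <|
        Finset.sum_congr rfl fun w _ => Finset.sum_congr rfl fun w' _ => by ring
  rw [h1]
  have h2 (e : Sym2 V) : d e * (∑ w, reducedIncMatrix r w e * reducedIncMatrix r w e +
      (∑ w, reducedIncMatrix r w e) * (∑ w, reducedIncMatrix r w e)) =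
      2 * if e ∈ G.edgeSet then 1 else 0 := by
    by_cases he : e ∈ G.edgeSet
    · rw [sum_sq_reducedIncMatrix r (G.not_isDiag_of_mem_edgeSet he)]; simp [hd, he]
    · simp [hd, he]
  rw [Finset.sum_congr rfl fun e _ => h2 e, ← Finset.mul_sum, Finset.sum_boole]
  congr 3
  ext e
  simp

/-- `1 + J` with `J` the all-ones matrix has a symmetric square root. -/
theorem exists_sq_eq_one_add_ones (ι : Type*) [Fintype ι] [DecidableEq ι] [Nonempty ι] :
    ∃ S : Matrix ι ι ℝ, S.transpose = S ∧ S * S = 1 + Matrix.of fun _ _ => 1 := by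
  have hn : (0 : ℝ) < Fintype.card ι := by exact_mod_cast Fintype.card_pos
  set n : ℝ := (Fintype.card ι : ℝ)
  set a : ℝ := (√(1 + n) - 1) / n with ha
  have hs : √(1 + n) * √(1 + n) = 1 + n := Real.mul_self_sqrt (by positivity)
  have hA : 2 * a + a * a * n = 1 := by
    rw [ha]; field_simp; linear_combination hs
  refine ⟨1 + Matrix.of fun _ _ => a, ?_, ?_⟩
  · ext i j; simp [Matrix.transpose_apply, Matrix.one_apply, eq_comm]
  · simp only [add_mul, mul_add, one_mul, mul_one]
    rw [add_assoc]
    congr 1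
    ext i j
    simp only [Matrix.add_apply, Matrix.of_apply, Matrix.mul_apply, Finset.sum_const,
      Finset.card_univ, nsmul_eq_mul]
    linear_combination hA

theorem det_one_add_ones (ι R : Type*) [Fintype ι] [DecidableEq ι] [CommRing R] (a : R) :
    (1 + Matrix.of fun _ _ : ι => a).det = 1 + Fintype.card ι * a := by
  have h := Matrix.det_one_add_replicateCol_mul_replicateRow (ι := Unit) (fun _ : ι => a)
    (fun _ => (1 : R))
  have : (Matrix.of fun _ _ : ι => a) =
      Matrix.replicateCol Unit (fun _ : ι => a) * Matrix.replicateRow Unit (fun _ : ι => (1 : R)) := by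
    ext i j; simp [Matrix.mul_apply]
  rw [this, h]
  simp [dotProduct]

/-- **Grimmett's bound** on the number of spanning trees. -/
theorem card_mul_numSpanningTrees_le {V : Type*} [Fintype V] [Nontrivial V] (G : SimpleGraph V) :
    (Fintype.card V : ℝ) * numSpanningTrees G ≤
      (2 * G.edgeFinset.card / (Fintype.card V - 1 : ℝ)) ^ (Fintype.card V - 1) := by
  obtain ⟨r, r', hr⟩ := exists_pair_ne V
  have : Nonempty {v : V // v ≠ r} := ⟨⟨r', hr.symm⟩⟩
  have hV : 1 ≤ Fintype.card V := Fintype.card_pos_iff.2 ⟨r⟩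
  have hcard : Fintype.card {v : V // v ≠ r} = Fintype.card V - 1 := by
    rw [Fintype.card_subtype_compl, Fintype.card_subtype_eq]
  obtain ⟨S, hSt, hSS⟩ := exists_sq_eq_one_add_ones {v : V // v ≠ r}
  set L := reducedIncMatrix r * Matrix.diagonal (fun e => if e ∈ G.edgeSet then (1 : ℤ) else 0) *
      (reducedIncMatrix r).transpose with hL
  let φ := Int.castRingHom ℝ
  set D := Matrix.diagonal (fun e => if e ∈ G.edgeSet then (1 : ℝ) else 0) with hD
  have hDD : D * D.transpose = D := by
    rw [hD, Matrix.diagonal_transpose, Matrix.diagonal_mul_diagonal]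
    congr 1; ext e; split_ifs <;> simp
  have hLD : L.map φ = (reducedIncMatrix r).map φ * D * ((reducedIncMatrix r).map φ).transpose := by
    rw [hL, Matrix.map_mul, Matrix.map_mul, Matrix.diagonal_map (map_zero φ), Matrix.transpose_map,
      hD]
    congr 3; ext e; simp [φ]
  have hpsd : (S * L.map φ * S).PosSemidef := by
    have h := Matrix.posSemidef_self_mul_conjTranspose (S * (reducedIncMatrix r).map φ * D)
    rw [Matrix.conjTranspose_eq_transpose_of_trivial, Matrix.transpose_mul, Matrix.transpose_mul,
      hSt] at h
    convert h using 1
    rw [hLD]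
    nth_rewrite 1 [← hDD]
    simp only [Matrix.mul_assoc]
  have hdet : (S * L.map φ * S).det = Fintype.card V * numSpanningTrees G := by
    have h1 : (L.map φ).det = (numSpanningTrees G : ℝ) := by
      have := congrArg φ (det_reducedLaplacian G r)
      rw [RingHom.map_det] at this
      simpa [φ] using this
    have h2 : S.det * S.det = Fintype.card V := by
      rw [← Matrix.det_mul, hSS, det_one_add_ones, hcard, Nat.cast_sub hV]
      push_cast; ring
    rw [Matrix.det_mul, Matrix.det_mul, h1, mul_right_comm, h2]
  have htr : (S * L.map φ * S).trace = 2 * (G.edgeFinset.card : ℝ) := by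
    have h := congrArg φ (trace_reducedLaplacian_mul G r)
    rw [← hL] at h
    rw [Matrix.mul_assoc, Matrix.trace_mul_comm, Matrix.mul_assoc, hSS]
    have h' : φ ((L * (1 + Matrix.of fun _ _ => 1)).trace) =
        (L.map φ * (1 + Matrix.of fun _ _ => 1)).trace := by
      simp [mul_add, Matrix.trace, Matrix.mul_apply, φ]
    rw [← h', h]
    simp [φ]
  have h := hpsd.det_le_trace_div_pow
  rw [hdet, htr, hcard, Nat.cast_sub hV, Nat.cast_one] at h
  exact h

theorem reducedIncMatrix_mul_mk {V : Type*} {r : V} (w w' : {v : V // v ≠ r}) (a b : V) :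
    reducedIncMatrix r w s(a, b) * reducedIncMatrix r w' s(a, b) =
      ((if a = w then 1 else 0) - (if b = w then 1 else 0)) *
      ((if a = w' then 1 else 0) - (if b = w' then 1 else 0)) := by
  rcases reducedIncMatrix_mk (r := r) (a := a) (b := b) with h | h
  · rw [h, h]
  · rw [h, h]; ring

theorem reducedLaplacian_top {V : Type*} [Fintype V] (r : V) :
    reducedIncMatrix r * Matrix.diagonal
        (fun e => if e ∈ (⊤ : SimpleGraph V).edgeSet then (1 : ℤ) else 0) *
      (reducedIncMatrix r).transpose = (Fintype.card V : ℤ) • 1 - Matrix.of fun _ _ => 1 := by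
  ext x y
  rw [Matrix.mul_apply]
  simp only [Matrix.mul_diagonal, Matrix.transpose_apply, Matrix.sub_apply, Matrix.smul_apply,
    Matrix.one_apply, Matrix.of_apply]
  have hterm (e : Sym2 V) : reducedIncMatrix r x e *
      (if e ∈ (⊤ : SimpleGraph V).edgeSet then (1 : ℤ) else 0) * reducedIncMatrix r y e =
      if x = y then (if e ∈ (⊤ : SimpleGraph V).incidenceFinset x then 1 else 0)
      else (if e = s((x : V), (y : V)) then -1 else 0) := by
    induction e with | _ a b
    rw [mul_right_comm, reducedIncMatrix_mul_mk]
    by_cases hab : a = b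
    · subst hab
      have : s(a, a) = s((x : V), (y : V)) ↔ a = x ∧ a = y := by
        simp [and_comm]
      have hxy : x = y ↔ (x : V) = y := Subtype.ext_iff
      simp only [SimpleGraph.mem_edgeSet, SimpleGraph.top_adj, ne_eq, not_true_eq_false, if_false,
        mul_zero, SimpleGraph.mem_incidenceFinset, SimpleGraph.mk'_mem_incidenceSet_iff, false_and,
        this]
      split_ifs with h1 h2
      · rfl
      · exact absurd (h2.1.symm.trans h2.2) (fun h => h1 (hxy.2 h))
      · rfl
    · by_cases hxy : x = y
      · subst hxy
        simp only [SimpleGraph.mem_edgeSet, SimpleGraph.top_adj, ne_eq, hab, not_false_eq_true,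
          if_true, mul_one, SimpleGraph.mem_incidenceFinset, SimpleGraph.mk'_mem_incidenceSet_iff,
          true_and]
        by_cases h1 : a = x <;> by_cases h2 : b = x
        · exact absurd (h1.trans h2.symm) hab
        · simp [h1, h2, Ne.symm h2]
        · simp [h1, h2, Ne.symm h1]
        · simp [h1, h2, Ne.symm h1, Ne.symm h2]
      · have hxy' : (x : V) ≠ y := fun h => hxy (Subtype.ext h)
        simp only [SimpleGraph.mem_edgeSet, SimpleGraph.top_adj, ne_eq, hab, not_false_eq_true,
          if_true, mul_one, hxy, if_false, Sym2.eq_iff]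
        grind
  rw [Finset.sum_congr rfl fun e _ => hterm e]
  by_cases hxy : x = y
  · subst hxy
    simp only [if_true, Finset.sum_boole, Finset.filter_mem_eq_inter, Finset.univ_inter,
      SimpleGraph.card_incidenceFinset_eq_degree, SimpleGraph.complete_graph_degree]
    rw [Nat.cast_sub (Fintype.card_pos_iff.2 ⟨r⟩)]
    simp
  · simp [hxy]

/-- **Cayley's formula**. -/
theorem numSpanningTrees_top_mul (V : Type*) [Fintype V] [Nonempty V] :
    numSpanningTrees (⊤ : SimpleGraph V) * Fintype.card V ^ 2 = Fintype.card V ^ Fintype.card V := by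
  obtain ⟨r⟩ := ‹Nonempty V›
  have hV : 1 ≤ Fintype.card V := Fintype.card_pos_iff.2 ⟨r⟩
  have hcard : Fintype.card {v : V // v ≠ r} = Fintype.card V - 1 := by
    rw [Fintype.card_subtype_compl, Fintype.card_subtype_eq]
  have hdet : ((Fintype.card V : ℤ) • 1 - Matrix.of fun _ _ => 1 :
      Matrix {v : V // v ≠ r} {v : V // v ≠ r} ℤ).det =
      (numSpanningTrees (⊤ : SimpleGraph V) : ℤ) := by
    rw [← reducedLaplacian_top r]
    convert det_reducedLaplacian (⊤ : SimpleGraph V) r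
  have hones := det_one_add_ones {v : V // v ≠ r} ℤ 1
  have hprod : ((Fintype.card V : ℤ) • 1 - Matrix.of fun _ _ => 1 :
      Matrix {v : V // v ≠ r} {v : V // v ≠ r} ℤ) * (1 + Matrix.of fun _ _ => 1) =
      (Fintype.card V : ℤ) • 1 := by
    set J : Matrix {v : V // v ≠ r} {v : V // v ≠ r} ℤ := Matrix.of fun _ _ => 1 with hJ
    have hJJ : J * J = ((Fintype.card V : ℤ) - 1) • J := by
      ext i j
      simp only [hJ, Matrix.mul_apply, Matrix.of_apply, Finset.sum_const, Finset.card_univ, hcard,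
        Matrix.smul_apply, smul_eq_mul, mul_one, nsmul_eq_mul, Nat.cast_sub hV, Nat.cast_one]
    simp only [sub_mul, mul_add, mul_one, smul_mul_assoc, one_mul, hJJ]
    module
  have h := congrArg Matrix.det hprod
  rw [Matrix.det_mul, hdet, hones, Matrix.det_smul, Matrix.det_one, hcard, Nat.cast_sub hV] at h
  zify
  calc (numSpanningTrees (⊤ : SimpleGraph V) : ℤ) * (Fintype.card V : ℤ) ^ 2
      = (numSpanningTrees (⊤ : SimpleGraph V) *
        (1 + ((Fintype.card V : ℤ) - ((1 : ℕ) : ℤ)) * 1)) * Fintype.card V := by push_cast; ring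
    _ = (Fintype.card V : ℤ) ^ (Fintype.card V - 1) * Fintype.card V := by rw [h, mul_one]
    _ = _ := by rw [← pow_succ, Nat.sub_add_cancel hV]

section TreePartition

variable {V W κ : Type*}

/-- The edges of `T` joining two vertices of the same colour. -/
def monoSubgraph (T : SimpleGraph V) (f : V → κ) : SimpleGraph V where
  Adj u v := T.Adj u v ∧ f u = f v
  symm := ⟨fun _ _ h => ⟨h.1.symm, h.2.symm⟩⟩
  loopless := ⟨fun _ h => T.irrefl h.1⟩

theorem monoSubgraph_le (T : SimpleGraph V) (f : V → κ) : monoSubgraph T f ≤ T :=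
  fun _ _ h => h.1

/-- The colour classes of `f` have size `n` and are connected in `T`. -/
def IsConnectedEquipartition [Fintype V] (T : SimpleGraph V) (f : V → κ) (n : ℕ) : Prop :=
  (∀ j, (univ.filter fun v => f v = j).card = n) ∧
    ∀ u v, f u = f v → (monoSubgraph T f).Reachable u v

theorem IsConnectedEquipartition.comap [Fintype V] [Fintype W] {T : SimpleGraph W} {f : W → κ}
    {n : ℕ} (h : IsConnectedEquipartition T f n) (σ : V ≃ W) :
    IsConnectedEquipartition (T.comap σ) (f ∘ σ) n := by
  refine ⟨fun j => ?_, fun u v huv => ?_⟩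
  · rw [← h.1 j]
    refine Finset.card_bij (fun v _ => σ v) (by simp) (by simp) fun w hw => ⟨σ.symm w, ?_⟩
    simpa using hw
  · let φ : monoSubgraph T f →g monoSubgraph (T.comap σ) (f ∘ σ) :=
      { toFun := σ.symm
        map_rel' := fun {a b} hab => by simpa [monoSubgraph] using hab }
    simpa [φ] using (h.2 (σ u) (σ v) huv).map φ

/-- If the finite set `S` contains each class of `g` or misses it, then it meets the class in `0`
or `n` points. -/
theorem dvd_card_filter_of_saturated {S : Finset V} [Fintype V] {g : V → κ} {n : ℕ} {j : κ}
    (hn : (univ.filter fun v => g v = j).card = n)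
    (hS : ∀ a b, g a = j → g b = j → a ∈ S → b ∈ S) : n ∣ (S.filter fun v => g v = j).card := by
  by_cases h : ∃ a ∈ S, g a = j
  · obtain ⟨a, haS, haj⟩ := h
    refine dvd_of_eq ?_
    rw [← hn]
    congr 1
    ext b
    simp only [Finset.mem_filter, Finset.mem_univ, true_and]
    exact ⟨fun hb => ⟨hS a b haj hb haS, hb⟩, fun hb => hb.2⟩
  · push Not at h
    rw [Finset.filter_eq_empty_iff.2 fun a ha => h a ha]
    simp

theorem IsConnectedEquipartition.unique_of_adj [Fintype V] [Fintype κ] {T : SimpleGraph V}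
    (hT : T.IsAcyclic) {f g : V → κ} {n : ℕ} (hf : IsConnectedEquipartition T f n)
    (hg : IsConnectedEquipartition T g n) {u v : V} (huv : T.Adj u v) (hfuv : f u = f v) :
    g u = g v := by
  by_contra hguv
  set H := T.deleteEdges {s(u, v)} with hH
  have hbridge : ¬ H.Reachable u v :=
    SimpleGraph.isBridge_iff.1 (SimpleGraph.isAcyclic_iff_forall_adj_isBridge.1 hT huv)
  let S : Finset V := univ.filter fun w => H.Reachable u w
  have hgS (j a b) (ha : g a = j) (hb : g b = j) (haS : a ∈ S) : b ∈ S := by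
    have hle : monoSubgraph T g ≤ H := by
      intro x y hxy
      rw [hH, SimpleGraph.deleteEdges_adj]
      refine ⟨hxy.1, fun h => hguv ?_⟩
      rcases Sym2.eq_iff.1 (Set.mem_singleton_iff.1 h) with ⟨rfl, rfl⟩ | ⟨rfl, rfl⟩
      · exact hxy.2
      · exact hxy.2.symm
    have hr := (hg.2 a b (ha.trans hb.symm)).mono hle
    simp only [S, Finset.mem_filter, Finset.mem_univ, true_and] at haS ⊢
    exact haS.trans hr
  have hfS (j) (hj : j ≠ f u) (a b) (ha : f a = j) (hb : f b = j) (haS : a ∈ S) : b ∈ S := by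
    have hwalk (x y : V) (p : (monoSubgraph T f).Walk x y) (hx : f x ≠ f u) : H.Reachable x y := by
      induction p with
      | nil => exact SimpleGraph.Reachable.refl _
      | @cons x z y hxz p ih =>
        refine SimpleGraph.Reachable.trans (SimpleGraph.Adj.reachable ?_) (ih (hxz.2 ▸ hx))
        rw [hH, SimpleGraph.deleteEdges_adj]
        refine ⟨hxz.1, fun h => hx ?_⟩
        rcases Sym2.eq_iff.1 (Set.mem_singleton_iff.1 h) with ⟨rfl, rfl⟩ | ⟨rfl, rfl⟩
        · rfl
        · exact hfuv.symm
    obtain ⟨p⟩ := hf.2 a b (ha.trans hb.symm)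
    simp only [S, Finset.mem_filter, Finset.mem_univ, true_and] at haS ⊢
    exact haS.trans (hwalk a b p (ha ▸ hj))
  have hdvd : n ∣ S.card := by
    rw [Finset.card_eq_sum_card_fiberwise (f := g) (t := univ) (by simp)]
    exact Finset.dvd_sum fun j _ => dvd_card_filter_of_saturated (hg.1 j) (hgS j)
  have hdvd' : n ∣ (S.filter fun w => f w = f u).card := by
    rw [Finset.card_eq_sum_card_fiberwise (f := f) (t := univ) (by simp),
      ← Finset.add_sum_erase _ _ (Finset.mem_univ (f u))] at hdvd
    refine (Nat.dvd_add_left (Finset.dvd_sum fun j hj => ?_)).1 hdvd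
    exact dvd_card_filter_of_saturated (hf.1 j) (hfS j (Finset.ne_of_mem_erase hj))
  have hpos : 0 < (S.filter fun w => f w = f u).card :=
    Finset.card_pos.2 ⟨u, by simp [S]⟩
  have hlt : (S.filter fun w => f w = f u).card < n := by
    rw [← hf.1 (f u)]
    refine Finset.card_lt_card ((Finset.ssubset_iff_of_subset
      (Finset.filter_subset_filter _ (Finset.subset_univ _))).2 ⟨v, ?_, ?_⟩)
    · simp [hfuv]
    · simp [S, hbridge]
  exact absurd (Nat.le_of_dvd hpos hdvd') (by omega)

/-- A tree has at most one partition into connected classes of a given size. -/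
theorem IsConnectedEquipartition.unique [Fintype V] [Fintype κ] {T : SimpleGraph V}
    (hT : T.IsAcyclic) {f g : V → κ} {n : ℕ} (hf : IsConnectedEquipartition T f n)
    (hg : IsConnectedEquipartition T g n) {u v : V} (huv : f u = f v) : g u = g v := by
  obtain ⟨p⟩ := hf.2 u v huv
  clear huv
  induction p with
  | nil => rfl
  | cons h _ ih => exact (hf.unique_of_adj hT hg h.1 h.2).trans ih

theorem IsConnectedEquipartition.isSplittable [Fintype V] {T : SimpleGraph V} {f : V → κ} {n k : ℕ}
    (hf : IsConnectedEquipartition T f n) (F : Finset (Sym2 V)) (hF : F.card = k - 1)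
    (hmem : ∀ u v, s(u, v) ∈ F ↔ T.Adj u v ∧ f u ≠ f v) : IsSplittable T k n := by
  have hdel : T.deleteEdges ↑F = monoSubgraph T f := by
    ext u v
    rw [SimpleGraph.deleteEdges_adj, Finset.mem_coe, hmem]
    simp only [monoSubgraph]
    tauto
  refine ⟨F, ?_, hF, fun c => ?_⟩
  · intro e
    induction e with | _ u v
    intro he
    exact ((hmem u v).1 he).1
  · revert c; rw [hdel]; intro c
    induction c using SimpleGraph.ConnectedComponent.ind with | _ v
    rw [← hf.1 (f v), ← Set.ncard_coe_finset]
    congr 1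
    ext w
    simp only [SimpleGraph.ConnectedComponent.mem_supp_iff, SimpleGraph.ConnectedComponent.eq,
      Finset.coe_filter, Finset.mem_univ, true_and, Set.mem_ofPred_eq]
    refine ⟨fun hr => ?_, fun h => hf.2 _ _ h⟩
    obtain ⟨p⟩ := hr
    induction p with
    | nil => rfl
    | cons h _ ih => exact h.2.trans ih

end TreePartition

section GluedTree

variable {W : Type*} {r : ℕ}

/-- The edge joining the `0`-th copy of `W` to the `j + 1`-st one. -/
def linkEdge (ab : Fin r → W × W) (j : Fin r) : Sym2 (Fin (r + 1) × W) :=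
  s((0, (ab j).1), (j.succ, (ab j).2))

theorem linkEdge_eq_iff (ab : Fin r → W × W) (j : Fin r) (u v : Fin (r + 1) × W) :
    linkEdge ab j = s(u, v) ↔
      (u = (0, (ab j).1) ∧ v = (j.succ, (ab j).2)) ∨
        (v = (0, (ab j).1) ∧ u = (j.succ, (ab j).2)) := by
  rw [linkEdge, Sym2.eq_iff]
  grind

theorem linkEdge_injective (ab : Fin r → W × W) : Function.Injective (linkEdge ab) := by
  intro i j h
  rw [eq_comm, linkEdge, linkEdge, Sym2.eq_iff] at h
  simp only [Prod.mk.injEq, Fin.succ_ne_zero, false_and, and_false, or_false] at h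
  exact (Fin.succ_injective _ h.2.1).symm

/-- The graph on `r + 1` copies of `W` made of a graph on each copy and of `r` linking edges. -/
def gluedGraph (t : Fin (r + 1) → SimpleGraph W) (ab : Fin r → W × W) :
    SimpleGraph (Fin (r + 1) × W) where
  Adj u v := (u.1 = v.1 ∧ (t u.1).Adj u.2 v.2) ∨ ∃ j, linkEdge ab j = s(u, v)
  symm := ⟨fun u v h => by
    rcases h with ⟨h, h'⟩ | h
    · exact Or.inl ⟨h.symm, h ▸ h'.symm⟩
    · exact Or.inr (by rwa [Sym2.eq_swap])⟩
  loopless := ⟨fun u h => by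
    rcases h with ⟨-, h⟩ | ⟨j, h⟩
    · exact (t u.1).irrefl h
    · rw [linkEdge_eq_iff] at h
      rcases h with ⟨h, h'⟩ | ⟨h, h'⟩ <;>
        exact Fin.succ_ne_zero j (congrArg Prod.fst (h'.symm.trans h))⟩

theorem fst_ne_of_linkEdge_eq {ab : Fin r → W × W} {j : Fin r} {u v : Fin (r + 1) × W}
    (h : linkEdge ab j = s(u, v)) : u.1 ≠ v.1 := by
  rcases (linkEdge_eq_iff ab j u v).1 h with ⟨rfl, rfl⟩ | ⟨rfl, rfl⟩
  · exact (Fin.succ_ne_zero j).symm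
  · exact Fin.succ_ne_zero j

theorem mem_image_linkEdge_iff (t : Fin (r + 1) → SimpleGraph W) (ab : Fin r → W × W)
    (u v : Fin (r + 1) × W) :
    s(u, v) ∈ univ.image (linkEdge ab) ↔ (gluedGraph t ab).Adj u v ∧ u.1 ≠ v.1 := by
  simp only [Finset.mem_image, Finset.mem_univ, true_and, gluedGraph]
  exact ⟨fun h => ⟨Or.inr h, fst_ne_of_linkEdge_eq h.choose_spec⟩,
    fun h => h.1.resolve_left fun h' => h.2 h'.1⟩

theorem gluedGraph_adj_same (t : Fin (r + 1) → SimpleGraph W) (ab : Fin r → W × W)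
    (i : Fin (r + 1)) (x y : W) : (gluedGraph t ab).Adj (i, x) (i, y) ↔ (t i).Adj x y :=
  ⟨fun h => (h.resolve_right fun ⟨_, h'⟩ => fst_ne_of_linkEdge_eq h' rfl).2,
    fun h => Or.inl ⟨rfl, h⟩⟩

theorem gluedGraph_adj_zero_succ (t : Fin (r + 1) → SimpleGraph W) (ab : Fin r → W × W)
    (j : Fin r) (x y : W) : (gluedGraph t ab).Adj (0, x) (j.succ, y) ↔ ab j = (x, y) := by
  simp only [gluedGraph, linkEdge_eq_iff, (Fin.succ_ne_zero j).symm, Prod.mk.injEq,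
    Fin.succ_ne_zero, Fin.succ_inj]
  grind

theorem gluedGraph_injective :
    Function.Injective fun d : (Fin (r + 1) → SimpleGraph W) × (Fin r → W × W) =>
      gluedGraph d.1 d.2 := by
  rintro ⟨t, ab⟩ ⟨t', ab'⟩ h
  simp only at h
  refine Prod.ext (funext fun i => ?_) (funext fun j => ?_)
  · ext x y
    rw [← gluedGraph_adj_same t ab, h, gluedGraph_adj_same]
  · have := (gluedGraph_adj_zero_succ t ab j (ab j).1 (ab j).2).2 rfl
    rw [h, gluedGraph_adj_zero_succ] at this
    exact this.symm

variable {t : Fin (r + 1) → SimpleGraph W}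

theorem isConnectedEquipartition_gluedGraph [Fintype W] (ht : ∀ i, (t i).Connected)
    (ab : Fin r → W × W) :
    IsConnectedEquipartition (gluedGraph t ab) Prod.fst (Fintype.card W) := by
  refine ⟨fun i => ?_, ?_⟩
  · rw [← Finset.card_univ]
    exact (Finset.card_bij (fun w _ => (i, w)) (by simp) (by simp) (by simp)).symm
  · rintro ⟨i, x⟩ ⟨j, y⟩ (rfl : i = j)
    let φ : t i →g monoSubgraph (gluedGraph t ab) Prod.fst :=
      { toFun := Prod.mk i
        map_rel' := fun h => ⟨(gluedGraph_adj_same t ab i _ _).2 h, rfl⟩ }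
    exact ((ht i).preconnected x y).map φ

theorem gluedGraph_connected [Fintype W] (ht : ∀ i, (t i).Connected) (ab : Fin r → W × W) :
    (gluedGraph t ab).Connected := by
  obtain ⟨w⟩ := (ht 0).nonempty
  have hfib (i : Fin (r + 1)) (x y : W) : (gluedGraph t ab).Reachable (i, x) (i, y) :=
    ((isConnectedEquipartition_gluedGraph ht ab).2 (i, x) (i, y) rfl).mono (monoSubgraph_le _ _)
  have hroot (u : Fin (r + 1) × W) : (gluedGraph t ab).Reachable u (0, w) := by
    obtain ⟨i, x⟩ := u
    refine Fin.cases (hfib 0 x w) (fun j => ?_) i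
    have hadj : (gluedGraph t ab).Adj (0, (ab j).1) (j.succ, (ab j).2) :=
      (gluedGraph_adj_zero_succ t ab j _ _).2 rfl
    exact (hfib j.succ x _).trans (hadj.symm.reachable.trans (hfib 0 _ w))
  exact { preconnected := fun u v => (hroot u).trans (hroot v).symm
          nonempty := ⟨(0, w)⟩ }

theorem gluedGraph_isTree [Fintype W] (ht : ∀ i, (t i).IsTree) (ab : Fin r → W × W) :
    (gluedGraph t ab).IsTree := by
  have hconn := gluedGraph_connected (fun i => (ht i).connected) ab
  obtain ⟨w⟩ := (ht 0).connected.nonempty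
  have hW : 1 ≤ Fintype.card W := Fintype.card_pos_iff.2 ⟨w⟩
  refine SimpleGraph.isTree_iff_connected_and_card.2 ⟨hconn, ?_⟩
  refine le_antisymm ?_ hconn.card_vert_le_card_edgeSet_add_one
  have hsub : (gluedGraph t ab).edgeFinset ⊆
      (univ.biUnion fun i => (t i).edgeFinset.image (Sym2.map (Prod.mk i))) ∪
        univ.image (linkEdge ab) := by
    intro e
    induction e with | _ u v
    rw [SimpleGraph.mem_edgeFinset, SimpleGraph.mem_edgeSet]
    rintro (⟨h, h'⟩ | ⟨j, hj⟩)
    · refine Finset.mem_union_left _ (Finset.mem_biUnion.2 ⟨u.1, Finset.mem_univ _, ?_⟩)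
      refine Finset.mem_image.2 ⟨s(u.2, v.2), by simpa using h', ?_⟩
      rw [Sym2.map_mk]
      exact congrArg (fun x => s(u, x)) (Prod.ext h rfl)
    · exact Finset.mem_union_right _ (Finset.mem_image.2 ⟨j, Finset.mem_univ _, hj⟩)
  have hcard (i) : (t i).edgeFinset.card = Fintype.card W - 1 :=
    Nat.eq_sub_of_add_eq (ht i).card_edgeFinset
  have h1 : (univ.biUnion fun i =>
      (t i).edgeFinset.image (Sym2.map (Prod.mk i))).card ≤ (r + 1) * (Fintype.card W - 1) := by
    refine Finset.card_biUnion_le.trans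
      ((Finset.sum_le_sum fun i _ => Finset.card_image_le.trans (hcard i).le).trans ?_)
    simp
  have h2 : (univ.image (linkEdge ab)).card ≤ r := Finset.card_image_le.trans (by simp)
  have h3 := (Finset.card_le_card hsub).trans (Finset.card_union_le _ _)
  have h4 : (r + 1) * (Fintype.card W - 1) + r + 1 = (r + 1) * Fintype.card W := by
    obtain ⟨s, hs⟩ := Nat.exists_eq_add_of_le hW
    rw [hs, Nat.add_sub_cancel_left]
    ring
  rw [Nat.card_eq_fintype_card, Nat.card_eq_fintype_card, ← SimpleGraph.edgeFinset_card,
    Fintype.card_prod, Fintype.card_fin]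
  omega

end GluedTree

section SplittableCount

variable {V W κ : Type*} [Fintype V] [Fintype W] [Fintype κ]

/-- A tree has few identifications of its vertex set with `κ × W` that make the fibres over `κ`
connected. -/
theorem card_equiv_isConnectedEquipartition_le [DecidableEq V] [DecidableEq κ] [Nonempty W]
    {T : SimpleGraph V} (hT : T.IsAcyclic) (n : ℕ) :
    (univ.filter fun σ : V ≃ κ × W => IsConnectedEquipartition T (Prod.fst ∘ σ) n).card ≤
      Fintype.card κ ^ Fintype.card κ * (Fintype.card W).factorial ^ Fintype.card κ := by
  rcases Finset.eq_empty_or_nonempty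
    (univ.filter fun σ : V ≃ κ × W => IsConnectedEquipartition T (Prod.fst ∘ σ) n) with h | ⟨σ₀, h₀⟩
  · simp [h]
  obtain ⟨w⟩ := ‹Nonempty W›
  have hfst (σ : V ≃ κ × W) (hσ : IsConnectedEquipartition T (Prod.fst ∘ σ) n) (i : κ) (x y : W) :
      (σ (σ₀.symm (i, x))).1 = (σ (σ₀.symm (i, y))).1 :=
    (Finset.mem_filter.1 h₀).2.unique hT hσ (by simp)
  let S := {σ : V ≃ κ × W // IsConnectedEquipartition T (Prod.fst ∘ σ) n}
  let code (σ : S) : (κ → κ) × (κ → W ↪ W) :=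
    (fun i => (σ.1 (σ₀.symm (i, w))).1, fun i => ⟨fun x => (σ.1 (σ₀.symm (i, x))).2, fun x y hxy => by
      simpa using σ.1.injective (Prod.ext (hfst σ.1 σ.2 i x y) hxy)⟩)
  have hcode : Function.Injective code := by
    intro σ τ h
    refine Subtype.ext (Equiv.ext fun v => ?_)
    obtain ⟨⟨i, x⟩, rfl⟩ := σ₀.symm.surjective v
    refine Prod.ext ?_ ?_
    · rw [hfst σ.1 σ.2 i x w, hfst τ.1 τ.2 i x w]
      exact congrFun (congrArg Prod.fst h) i
    · exact DFunLike.congr_fun (congrFun (congrArg Prod.snd h) i) x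
  rw [← Fintype.card_subtype]
  refine (Fintype.card_le_of_injective code hcode).trans (le_of_eq ?_)
  simp [Fintype.card_embedding_eq, Nat.descFactorial_self]

theorem numSpanningTrees_top_eq (W : Type*) [Fintype W] :
    numSpanningTrees (⊤ : SimpleGraph W) = Fintype.card {T : SimpleGraph W // T.IsTree} := by
  simp only [numSpanningTrees, le_top, true_and]
  rw [← Nat.card_eq_fintype_card]
  rfl

theorem comap_gluedGraph_mem {r : ℕ} {t : Fin (r + 1) → SimpleGraph W} (ht : ∀ i, (t i).IsTree)
    (ab : Fin r → W × W) (σ : V ≃ Fin (r + 1) × W) :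
    ((gluedGraph t ab).comap σ).IsTree ∧
      IsSplittable ((gluedGraph t ab).comap σ) (r + 1) (Fintype.card W) := by
  refine ⟨(SimpleGraph.Iso.comap σ _).isTree_iff.2 (gluedGraph_isTree ht ab), ?_⟩
  refine ((isConnectedEquipartition_gluedGraph (fun i => (ht i).connected) ab).comap σ).isSplittable
    ((univ.image (linkEdge ab)).image (Sym2.map σ.symm)) ?_ fun u v => ?_
  · rw [Finset.card_image_of_injective _ (Sym2.map.injective σ.symm.injective),
      Finset.card_image_of_injective _ (linkEdge_injective ab)]
    simp
  · have h := mem_image_linkEdge_iff t ab (σ u) (σ v)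
    rw [SimpleGraph.comap_adj, Function.comp, Function.comp, ← h, ← Sym2.map_mk,
      Finset.mem_image]
    refine ⟨?_, fun h => ⟨_, h, ?_⟩⟩
    · rintro ⟨e, he, h'⟩
      rw [← h', Sym2.map_map]
      simpa using he
    · simp

theorem factorial_mul_card_le_card_splittable [DecidableEq V] [Nonempty W] (r : ℕ)
    (hV : Fintype.card V = (r + 1) * Fintype.card W) :
    (Fintype.card V).factorial *
        (numSpanningTrees (⊤ : SimpleGraph W) ^ (r + 1) * (Fintype.card W ^ 2) ^ r) ≤
      ((r + 1) ^ (r + 1) * (Fintype.card W).factorial ^ (r + 1)) *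
        (univ.filter fun T : SimpleGraph V =>
          T.IsTree ∧ IsSplittable T (r + 1) (Fintype.card W)).card := by
  let D := (Fin (r + 1) → {T : SimpleGraph W // T.IsTree}) × (Fin r → W × W)
  let Φ (x : (V ≃ Fin (r + 1) × W) × D) : SimpleGraph V :=
    (gluedGraph (fun i => (x.2.1 i).1) x.2.2).comap x.1
  have hcard : Fintype.card ((V ≃ Fin (r + 1) × W) × D) = (Fintype.card V).factorial *
      (numSpanningTrees (⊤ : SimpleGraph W) ^ (r + 1) * (Fintype.card W ^ 2) ^ r) := by
    have e : V ≃ Fin (r + 1) × W := Fintype.equivOfCardEq (by simp [hV])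
    simp only [D, Fintype.card_prod, Fintype.card_equiv e, Fintype.card_fun, Fintype.card_fin,
      numSpanningTrees_top_eq, sq]
  rw [← hcard, ← Finset.card_univ]
  refine Finset.card_le_mul_card_image_of_maps_to (f := Φ) (fun x _ => ?_) _ fun T hT => ?_
  · exact Finset.mem_filter.2 ⟨Finset.mem_univ _, comap_gluedGraph_mem (fun i => (x.2.1 i).2) _ _⟩
  · have hTree : T.IsTree := (Finset.mem_filter.1 hT).2.1
    refine (Finset.card_le_card_of_injOn Prod.fst ?_ ?_).trans
      ((card_equiv_isConnectedEquipartition_le (κ := Fin (r + 1)) (W := W) hTree.isAcyclic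
        (Fintype.card W)).trans (by simp))
    · rintro ⟨σ, d⟩ hx
      have hx' : Φ (σ, d) = T := (Finset.mem_filter.1 hx).2
      refine Finset.mem_filter.2 ⟨Finset.mem_univ _, ?_⟩
      rw [← hx']
      exact (isConnectedEquipartition_gluedGraph (fun i => (d.1 i).2.connected) d.2).comap σ
    · rintro ⟨σ, d⟩ hx ⟨τ, d'⟩ hy (rfl : σ = τ)
      have hx' : Φ (σ, d) = T := (Finset.mem_filter.1 hx).2
      have hy' : Φ (σ, d') = T := (Finset.mem_filter.1 hy).2
      have h : gluedGraph (fun i => (d.1 i).1) d.2 = gluedGraph (fun i => (d'.1 i).1) d'.2 := by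
        ext u v
        simpa [Φ] using congrArg (fun G => G.Adj (σ.symm u) (σ.symm v)) (hx'.trans hy'.symm)
      have h' := gluedGraph_injective (a₁ := (fun i => (d.1 i).1, d.2))
        (a₂ := (fun i => (d'.1 i).1, d'.2)) h
      refine Prod.ext rfl (Prod.ext (funext fun i => Subtype.ext ?_) ?_)
      · exact congrFun (Prod.ext_iff.1 h').1 i
      · exact (Prod.ext_iff.1 h').2

theorem factorial_mul_pow_le_card_splittable {k n : ℕ} (hk : 1 ≤ k) (hn : 1 ≤ n) :
    (k * n).factorial * n ^ (k * n) ≤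
      k ^ k * n.factorial ^ k * (univ.filter fun T : SimpleGraph (Fin (k * n)) =>
          T.IsTree ∧ IsSplittable T k n).card * n ^ 2 := by
  obtain ⟨r, rfl⟩ := Nat.exists_eq_add_of_le' hk
  have : Nonempty (Fin n) := ⟨⟨0, hn⟩⟩
  have h := factorial_mul_card_le_card_splittable (V := Fin ((r + 1) * n)) (W := Fin n) r (by simp)
  have hcayley := numSpanningTrees_top_mul (Fin n)
  simp only [Fintype.card_fin] at h hcayley
  refine le_of_eq_of_le ?_ (Nat.mul_le_mul_right (n ^ 2) h)
  rw [mul_comm (r + 1) n, pow_mul, ← hcayley]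
  ring

end SplittableCount

section ConnectedGraphCount

variable {V : Type*} [Fintype V] [DecidableEq V]

/-- The connected graphs with `m` edges. -/
noncomputable def connectedGraphs (V : Type*) [Fintype V] [DecidableEq V] (m : ℕ) :
    Finset (SimpleGraph V) :=
  univ.filter fun G => G.Connected ∧ G.edgeFinset.card = m

theorem card_connectedGraphs_le (m : ℕ) :
    (connectedGraphs V m).card ≤ ((Fintype.card V).choose 2).choose m := by
  rw [← SimpleGraph.card_edgeFinset_top_eq_card_choose_two, ← Finset.card_powersetCard]
  refine Finset.card_le_card_of_injOn (fun G => G.edgeFinset) (fun G hG => ?_) fun G _ H _ h => ?_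
  · refine Finset.mem_coe.2 (Finset.mem_powersetCard.2 ⟨?_, (Finset.mem_filter.1 hG).2.2⟩)
    exact SimpleGraph.edgeFinset_mono le_top
  · exact SimpleGraph.edgeFinset_inj.1 h

theorem choose_le_card_connectedGraphs_above {T : SimpleGraph V} (hT : T.IsTree) {m : ℕ}
    (hm : Fintype.card V - 1 ≤ m) :
    ((Fintype.card V).choose 2 - (Fintype.card V - 1)).choose (m - (Fintype.card V - 1)) ≤
      ((connectedGraphs V m).filter fun G => T ≤ G).card := by
  have hcard : T.edgeFinset.card = Fintype.card V - 1 := Nat.eq_sub_of_add_eq hT.card_edgeFinset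
  have hTtop : T.edgeFinset ⊆ (⊤ : SimpleGraph V).edgeFinset := SimpleGraph.edgeFinset_mono le_top
  rw [← SimpleGraph.card_edgeFinset_top_eq_card_choose_two, ← hcard,
    ← Finset.card_sdiff_of_subset hTtop, ← Finset.card_powersetCard]
  have hedge (A) (hA : A ∈ ((⊤ : SimpleGraph V).edgeFinset \ T.edgeFinset).powersetCard
      (m - T.edgeFinset.card)) :
      (SimpleGraph.fromEdgeSet (↑(T.edgeFinset ∪ A) : Set (Sym2 V))).edgeSet =
        ↑(T.edgeFinset ∪ A) := by
    rw [SimpleGraph.edgeSet_fromEdgeSet, sdiff_eq_left, Set.disjoint_left]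
    intro e he
    have he' : e ∈ (⊤ : SimpleGraph V).edgeFinset := by
      rcases Finset.mem_union.1 (Finset.mem_coe.1 he) with h | h
      · exact hTtop h
      · exact (Finset.mem_sdiff.1 ((Finset.mem_powersetCard.1 hA).1 h)).1
    exact SimpleGraph.not_isDiag_of_mem_edgeFinset he'
  refine Finset.card_le_card_of_injOn
    (fun A => SimpleGraph.fromEdgeSet (↑(T.edgeFinset ∪ A) : Set (Sym2 V)))
    (fun A hA => ?_) fun A hA B hB h => ?_
  · have hdisj : Disjoint T.edgeFinset A :=
      Finset.disjoint_of_subset_right (Finset.mem_powersetCard.1 hA).1 Finset.disjoint_sdiff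
    have hle : T ≤ SimpleGraph.fromEdgeSet (↑(T.edgeFinset ∪ A) : Set (Sym2 V)) := by
      rw [← SimpleGraph.edgeSet_subset_edgeSet, hedge A hA]
      simp
    refine Finset.mem_coe.2 (Finset.mem_filter.2 ⟨Finset.mem_filter.2 ⟨Finset.mem_univ _,
      hT.connected.mono hle, ?_⟩, hle⟩)
    rw [← Set.ncard_coe_finset, SimpleGraph.coe_edgeFinset, hedge A hA, Set.ncard_coe_finset,
      Finset.card_union_of_disjoint hdisj, (Finset.mem_powersetCard.1 hA).2, hcard,
      Nat.add_sub_cancel' hm]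
  · have h' := congrArg SimpleGraph.edgeSet h
    simp only at h'
    rw [hedge A hA, hedge B hB, Finset.coe_inj] at h'
    have hdisj (C) (hC : C ∈ ((⊤ : SimpleGraph V).edgeFinset \ T.edgeFinset).powersetCard
        (m - T.edgeFinset.card)) : Disjoint C T.edgeFinset :=
      Finset.disjoint_of_subset_left (Finset.mem_powersetCard.1 hC).1 Finset.sdiff_disjoint
    rw [← Finset.union_sdiff_cancel_left (hdisj A hA).symm, h',
      Finset.union_sdiff_cancel_left (hdisj B hB).symm]

theorem card_splittable_mul_choose_le {k n m : ℕ} (hm : Fintype.card V - 1 ≤ m) :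
    (univ.filter fun T : SimpleGraph V => T.IsTree ∧ IsSplittable T k n).card *
        ((Fintype.card V).choose 2 - (Fintype.card V - 1)).choose (m - (Fintype.card V - 1)) ≤
      ∑ G ∈ connectedGraphs V m, numSplittableSpanningTrees G k n := by
  have h (G : SimpleGraph V) : numSplittableSpanningTrees G k n =
      ((univ.filter fun T : SimpleGraph V => T.IsTree ∧ IsSplittable T k n).filter
        fun T => T ≤ G).card := by
    rw [numSplittableSpanningTrees, ← Set.ncard_coe_finset]
    congr 1
    ext T
    simp [and_comm]
  simp only [h]
  refine le_trans ?_ (Finset.sum_card_bipartiteAbove_eq_sum_card_bipartiteBelow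
    (fun G T : SimpleGraph V => T ≤ G)).ge
  rw [← smul_eq_mul]
  refine Finset.card_nsmul_le_sum _ _ _ fun T hT => ?_
  exact choose_le_card_connectedGraphs_above (Finset.mem_filter.1 hT).2.1 hm

end ConnectedGraphCount

theorem le_gnmSplitProb {k n m : ℕ} (hN : 2 ≤ k * n) (hm : k * n - 1 ≤ m) :
    ((univ.filter fun T : SimpleGraph (Fin (k * n)) => T.IsTree ∧ IsSplittable T k n).card : ℝ) *
        (((k * n).choose 2 - (k * n - 1)).choose (m - (k * n - 1)) : ℕ) /
      (((k * n).choose 2).choose m * ((2 * m / ((k * n : ℕ) - 1 : ℝ)) ^ (k * n - 1) / (k * n : ℕ)))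
      ≤ gnmSplitProb k n m := by
  set S := univ.filter fun T : SimpleGraph (Fin (k * n)) => T.IsTree ∧ IsSplittable T k n
  set L := ((k * n).choose 2 - (k * n - 1)).choose (m - (k * n - 1))
  set B : ℝ := (2 * m / ((k * n : ℕ) - 1 : ℝ)) ^ (k * n - 1) / (k * n : ℕ) with hB
  have : Nontrivial (Fin (k * n)) := Fin.nontrivial_iff_two_le.2 hN
  have hN0 : (0 : ℝ) < (k * n : ℕ) := by exact_mod_cast (by omega : 0 < k * n)
  have hN1 : (0 : ℝ) ≤ ((k * n : ℕ) : ℝ) - 1 := by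
    rw [sub_nonneg]; exact_mod_cast (by omega : 1 ≤ k * n)
  have hB0 : 0 ≤ B := by positivity
  have hdouble : (S.card : ℝ) * L ≤ ∑ G ∈ connectedGraphs (Fin (k * n)) m,
      (numSplittableSpanningTrees G k n : ℝ) := by
    have := card_splittable_mul_choose_le (V := Fin (k * n)) (k := k) (n := n) (m := m)
      (by simpa using hm)
    rw [Fintype.card_fin] at this
    exact_mod_cast this
  have hterm (G) (hG : G ∈ connectedGraphs (Fin (k * n)) m) :
      (numSplittableSpanningTrees G k n : ℝ) / B ≤
        numSplittableSpanningTrees G k n / numSpanningTrees G := by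
    obtain ⟨hconn, hedge⟩ := (Finset.mem_filter.1 hG).2
    have hle : (numSpanningTrees G : ℝ) ≤ B := by
      have := card_mul_numSpanningTrees_le G
      rw [Fintype.card_fin] at this
      rw [hB, le_div_iff₀' hN0, ← hedge]
      convert this
    refine div_le_div_of_nonneg_left (Nat.cast_nonneg _) (Nat.cast_pos.2 ?_) hle
    obtain ⟨T, hTG, hT⟩ := hconn.exists_isTree_le
    exact (Set.ncard_pos (Set.toFinite _)).2 ⟨T, hTG, hT⟩
  have hsum : (S.card : ℝ) * L / B ≤ ∑ G ∈ connectedGraphs (Fin (k * n)) m,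
      (numSplittableSpanningTrees G k n : ℝ) / numSpanningTrees G := by
    refine (div_le_div_of_nonneg_right hdouble hB0).trans ?_
    rw [Finset.sum_div]
    exact Finset.sum_le_sum hterm
  rw [mul_comm _ B, ← div_div]
  change _ ≤ (∑ G ∈ connectedGraphs (Fin (k * n)) m, _ / _) /
    ((connectedGraphs (Fin (k * n)) m).card : ℝ)
  rcases Finset.eq_empty_or_nonempty (connectedGraphs (Fin (k * n)) m) with h | h
  · rw [h, Finset.sum_empty] at hsum ⊢
    rw [zero_div]
    exact div_nonpos_of_nonpos_of_nonneg hsum (Nat.cast_nonneg _)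
  · have hcard := card_connectedGraphs_le (V := Fin (k * n)) m
    rw [Fintype.card_fin] at hcard
    refine (div_le_div_of_nonneg_left (by positivity)
      (Nat.cast_pos.2 h.card_pos) (Nat.cast_le.2 hcard)).trans ?_
    exact div_le_div_of_nonneg_right hsum (Nat.cast_nonneg _)

section Estimates

theorem exp_neg_two_mul_le_one_sub {x : ℝ} (h0 : 0 ≤ x) (h1 : 2 * x ≤ 1) :
    Real.exp (-(2 * x)) ≤ 1 - x := by
  have h := Real.add_one_le_exp (2 * x)
  rw [Real.exp_neg, inv_le_comm₀ (Real.exp_pos _) (by linarith)]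
  refine le_trans ?_ h
  rw [inv_le_iff_one_le_mul₀' (by linarith)]
  nlinarith

theorem pow_mul_exp_le_descFactorial {m t : ℕ} (hm : 1 ≤ m) (ht : 2 * (t - 1) ≤ m) :
    (m : ℝ) ^ t * Real.exp (-(t * (t - 1)) / m) ≤ m.descFactorial t := by
  have hm0 : (0 : ℝ) < m := by exact_mod_cast hm
  induction t with
  | zero => simp
  | succ t ih =>
    have h2 : 2 * (t : ℝ) ≤ m := by exact_mod_cast ht
    have h := exp_neg_two_mul_le_one_sub (x := t / m) (by positivity)
      (by rw [← mul_div_assoc, div_le_one hm0]; exact h2)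
    rw [Nat.descFactorial_succ, Nat.cast_mul, Nat.cast_sub (by omega)]
    calc (m : ℝ) ^ (t + 1) * Real.exp (-((t + 1 : ℕ) * ((t + 1 : ℕ) - 1)) / m)
        = (m * Real.exp (-(2 * (t / m)))) * (m ^ t * Real.exp (-(t * (t - 1)) / m)) := by
          rw [mul_mul_mul_comm, ← Real.exp_add, ← pow_succ']
          congr 2
          push_cast
          ring
      _ ≤ (m * (1 - t / m)) * m.descFactorial t := by
          refine mul_le_mul (mul_le_mul_of_nonneg_left h hm0.le) (ih (by omega)) (by positivity) ?_
          exact mul_nonneg hm0.le ((Real.exp_pos _).le.trans h)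
      _ = _ := by rw [mul_one_sub, mul_div_cancel₀ _ hm0.ne']

theorem choose_mul_pow_mul_exp_le {M m t : ℕ} (hm : 1 ≤ m) (hmM : m ≤ M) (htm : t ≤ m)
    (ht : 2 * (t - 1) ≤ m) :
    (M.choose m : ℝ) * ((m / M : ℝ) ^ t * Real.exp (-(t * (t - 1)) / m)) ≤
      (M - t).choose (m - t) := by
  have hM0 : (0 : ℝ) < M := by exact_mod_cast hm.trans hmM
  have h1 := pow_mul_exp_le_descFactorial hm ht
  have h2 : (M.descFactorial t : ℝ) ≤ M ^ t := by exact_mod_cast Nat.descFactorial_le_pow M t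
  have h3 : (M.choose m : ℝ) * m.descFactorial t =
      M.descFactorial t * ((M - t).choose (m - t) : ℕ) := by
    rw [Nat.descFactorial_eq_factorial_mul_choose, Nat.descFactorial_eq_factorial_mul_choose]
    have := Nat.choose_mul (n := M) (k := m) (s := t) htm
    push_cast
    rw [mul_left_comm, mul_assoc]
    congr 1
    exact_mod_cast this
  rw [div_pow, div_mul_eq_mul_div, ← mul_div_assoc, div_le_iff₀ (by positivity), mul_comm _ (_ ^ t)]
  calc _ ≤ (M.choose m : ℝ) * m.descFactorial t := by gcongr
    _ = _ := h3
    _ ≤ _ := by gcongr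

theorem factorial_le_exp_mul_sqrt {n : ℕ} (hn : 1 ≤ n) :
    (n.factorial : ℝ) ≤ Real.exp 1 * √n * (n / Real.exp 1) ^ n := by
  have hn0 : (0 : ℝ) < n := by exact_mod_cast hn
  obtain ⟨s, rfl⟩ := Nat.exists_eq_add_of_le' hn
  have h : Stirling.stirlingSeq (s + 1) ≤ Stirling.stirlingSeq 1 :=
    Stirling.stirlingSeq'_antitone (Nat.zero_le s)
  rw [Stirling.stirlingSeq_one, Stirling.stirlingSeq, div_le_iff₀ (by positivity),
    Real.sqrt_mul zero_le_two] at h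
  refine h.trans (le_of_eq ?_)
  field_simp

theorem sqrt_mul_pow_le_factorial (n : ℕ) : √n * (n / Real.exp 1) ^ n ≤ n.factorial := by
  refine le_trans ?_ (Stirling.le_factorial_stirling n)
  gcongr
  nlinarith [Real.pi_gt_three, (Nat.cast_nonneg n : (0 : ℝ) ≤ n)]

theorem sqrt_mul_pow_le_card_splittable {k n : ℕ} (hk : 1 ≤ k) (hn : 1 ≤ n) :
    √n * ((k * n : ℕ) : ℝ) ^ (k * n) ≤ (k * Real.exp 1) ^ k * √n ^ k *
      (univ.filter fun T : SimpleGraph (Fin (k * n)) =>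
          T.IsTree ∧ IsSplittable T k n).card * ((k * n : ℕ) : ℝ) ^ 2 := by
  set S := (univ.filter fun T : SimpleGraph (Fin (k * n)) =>
          T.IsTree ∧ IsSplittable T k n).card
  have hn0 : (0 : ℝ) < n := by exact_mod_cast hn
  have hcount : ((k * n).factorial : ℝ) * n ^ (k * n) ≤ k ^ k * n.factorial ^ k * S * n ^ 2 := by
    exact_mod_cast factorial_mul_pow_le_card_splittable hk hn
  have hnN : (n : ℝ) ≤ (k * n : ℕ) := by exact_mod_cast Nat.le_mul_of_pos_left n hk
  have hpos : (0 : ℝ) < (n / Real.exp 1) ^ (k * n) := by positivity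
  refine le_of_mul_le_mul_right ?_ hpos
  calc √n * ((k * n : ℕ) : ℝ) ^ (k * n) * (n / Real.exp 1) ^ (k * n)
      = √n * ((k * n : ℕ) / Real.exp 1) ^ (k * n) * n ^ (k * n) := by
        rw [div_pow, div_pow]; ring
    _ ≤ √(k * n : ℕ) * ((k * n : ℕ) / Real.exp 1) ^ (k * n) * n ^ (k * n) := by gcongr
    _ ≤ (k * n).factorial * n ^ (k * n) := by
        gcongr
        exact sqrt_mul_pow_le_factorial _
    _ ≤ k ^ k * n.factorial ^ k * S * n ^ 2 := hcount
    _ ≤ k ^ k * (Real.exp 1 * √n * (n / Real.exp 1) ^ n) ^ k * S * (k * n : ℕ) ^ 2 := by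
        gcongr
        exact factorial_le_exp_mul_sqrt hn
    _ = _ := by
        rw [mul_comm k n, pow_mul]
        ring

end Estimates

section LowerBound

theorem rpow_one_sub_div_two {n : ℕ} (hn : 1 ≤ n) (k : ℕ) :
    (n : ℝ) ^ ((1 - (k : ℝ)) / 2) = √n / √n ^ k := by
  have hn0 : (0 : ℝ) < n := by exact_mod_cast hn
  rw [sub_div, Real.rpow_sub hn0, ← Real.sqrt_eq_rpow, div_eq_mul_one_div (k : ℝ) 2, mul_comm,
    Real.rpow_mul hn0.le, ← Real.sqrt_eq_rpow, Real.rpow_natCast]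

theorem two_mul_div_sub_one {N m : ℕ} (hN : 2 ≤ N) :
    2 * (m : ℝ) / ((N : ℝ) - 1) = m / (N.choose 2 : ℕ) * N := by
  have hN2 : (2 : ℝ) ≤ N := by exact_mod_cast hN
  have h1 : (N : ℝ) - 1 ≠ 0 := by linarith
  have h2 : (N : ℝ) ≠ 0 := by linarith
  rw [Nat.cast_choose_two]
  field_simp

theorem le_gnmSplitProb_of_two_mul_le {k n m : ℕ} (hk : 2 ≤ k) (hn : 1 ≤ n) (hm : k * n - 1 ≤ m)
    (hmM : m ≤ (k * n).choose 2) (hlarge : 2 * (k * n - 1 - 1) ≤ m) :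
    ((k * Real.exp 1) ^ k)⁻¹ * (n : ℝ) ^ ((1 - (k : ℝ)) / 2) *
      Real.exp (-2 / (m / ((k * n).choose 2 : ℕ))) ≤ gnmSplitProb k n m := by
  have hN : 2 ≤ k * n := hk.trans (Nat.le_mul_of_pos_right k hn)
  have hS := sqrt_mul_pow_le_card_splittable (by omega : 1 ≤ k) hn
  refine le_trans ?_ (le_gnmSplitProb hN hm)
  rw [two_mul_div_sub_one hN, rpow_one_sub_div_two hn]
  set S := (univ.filter fun T : SimpleGraph (Fin (k * n)) =>
          T.IsTree ∧ IsSplittable T k n).card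
  have hchoose := choose_mul_pow_mul_exp_le (by omega) hmM hm hlarge
  have hchoose_pos : (0 : ℝ) < ((k * n).choose 2).choose m := by
    exact_mod_cast Nat.choose_pos hmM
  have hchoose_two : (((k * n).choose 2 : ℕ) : ℝ) = (k * n : ℕ) * ((k * n : ℕ) - 1) / 2 :=
    Nat.cast_choose_two ℝ _
  have hk0 : (0 : ℝ) < k := by exact_mod_cast (by omega : 0 < k)
  have hn0 : (0 : ℝ) < n := by exact_mod_cast hn
  have hm0 : (0 : ℝ) < m := by exact_mod_cast (by omega : 0 < m)
  have hM0 : (0 : ℝ) < ((k * n).choose 2 : ℕ) := by exact_mod_cast (by omega : 0 < (k * n).choose 2)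
  set M := (k * n).choose 2
  obtain ⟨t, ht⟩ : ∃ t, k * n = t + 1 := ⟨k * n - 1, by omega⟩
  have htN : k * n - 1 = t := by omega
  rw [htN] at hchoose ⊢
  set N := k * n
  have hN0 : (0 : ℝ) < N := by exact_mod_cast (by omega : 0 < N)
  have hexp : Real.exp (-2 / (m / M)) ≤ Real.exp (-(t * (t - 1)) / m) := by
    refine Real.exp_le_exp.2 ?_
    rw [neg_div, neg_div, neg_le_neg_iff, div_div_eq_mul_div, hchoose_two, ht]
    refine div_le_div_of_nonneg_right ?_ hm0.le
    push_cast
    nlinarith [(Nat.cast_nonneg t : (0 : ℝ) ≤ t)]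
  have hS' : √n * (N : ℝ) ^ t ≤ (k * Real.exp 1) ^ k * √n ^ k * S * N := by
    refine le_of_mul_le_mul_right ?_ hN0
    calc √n * (N : ℝ) ^ t * N = √n * (N : ℝ) ^ N := by rw [mul_assoc, ← pow_succ, ← ht]
      _ ≤ _ := hS
      _ = _ := by ring
  have hsqrt : 0 < √(n : ℝ) := Real.sqrt_pos.2 hn0
  have hS'' : ((k * Real.exp 1) ^ k)⁻¹ * (√n / √n ^ k) ≤ S * N / (N : ℝ) ^ t := by
    rw [inv_mul_eq_div, div_div, div_le_div_iff₀ (by positivity) (by positivity)]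
    linarith
  have hD : 0 ≤ (M.choose m : ℝ) * ((m / M * N : ℝ) ^ t / N) :=
    mul_nonneg hchoose_pos.le (by positivity)
  calc _ ≤ S * N / (N : ℝ) ^ t * Real.exp (-2 / (m / M)) := by gcongr
    _ = S * ((M.choose m : ℝ) * ((m / M : ℝ) ^ t * Real.exp (-2 / (m / M)))) /
        (M.choose m * ((m / M * N : ℝ) ^ t / N)) := by
      rw [mul_pow]
      have : (m / M : ℝ) ^ t ≠ 0 := by positivity
      generalize (m / M : ℝ) ^ t = q at *
      generalize Real.exp (-2 / (m / M)) = e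
      field_simp
    _ ≤ S * ((M.choose m : ℝ) * ((m / M : ℝ) ^ t * Real.exp (-(t * (t - 1)) / m))) /
        (M.choose m * ((m / M * N : ℝ) ^ t / N)) :=
      div_le_div_of_nonneg_right (mul_le_mul_of_nonneg_left (mul_le_mul_of_nonneg_left
        (mul_le_mul_of_nonneg_left hexp (by positivity)) hchoose_pos.le) (Nat.cast_nonneg S)) hD
    _ ≤ _ := div_le_div_of_nonneg_right
      (mul_le_mul_of_nonneg_left hchoose (Nat.cast_nonneg S)) hD

theorem inv_le_gnmSplitProb {k n m K : ℕ} (hk : 2 ≤ k) (hn : 1 ≤ n) (hm : k * n - 1 ≤ m)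
    (hmM : m ≤ (k * n).choose 2) (hK : k * n ≤ K) :
    ((2 : ℝ) ^ K ^ 2 * (K : ℝ) ^ K)⁻¹ ≤ gnmSplitProb k n m := by
  have hN : 2 ≤ k * n := hk.trans (Nat.le_mul_of_pos_right k hn)
  refine le_trans ?_ (le_gnmSplitProb hN hm)
  have hcount := factorial_mul_pow_le_card_splittable (by omega : 1 ≤ k) hn
  rw [two_mul_div_sub_one hN, inv_eq_one_div]
  set S := (univ.filter fun T : SimpleGraph (Fin (k * n)) =>
          T.IsTree ∧ IsSplittable T k n).card
  have hS : 1 ≤ S := by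
    by_contra! h
    rw [Nat.lt_one_iff.1 h, mul_zero, zero_mul] at hcount
    exact absurd hcount (Nat.not_le.2 (by positivity))
  have hM0 : 0 < (k * n).choose 2 := by omega
  have hMK : (k * n).choose 2 ≤ K ^ 2 := (Nat.choose_le_pow _ _).trans (by gcongr)
  have hL : 1 ≤ ((k * n).choose 2 - (k * n - 1)).choose (m - (k * n - 1)) :=
    Nat.choose_pos (Nat.sub_le_sub_right hmM _)
  have hchoose : ((k * n).choose 2).choose m ≤ 2 ^ K ^ 2 :=
    (Nat.choose_le_two_pow _ _).trans (Nat.pow_le_pow_right two_pos hMK)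
  have hchoose_pos : 0 < ((k * n).choose 2).choose m := Nat.choose_pos hmM
  have hp : (m : ℝ) / ((k * n).choose 2 : ℕ) ≤ 1 :=
    div_le_one_of_le₀ (by exact_mod_cast hmM) (Nat.cast_nonneg _)
  have hm0 : 0 < m := by omega
  have hN1 : (1 : ℝ) ≤ (k * n : ℕ) := by exact_mod_cast (by omega : 1 ≤ k * n)
  have hKN : ((k * n : ℕ) : ℝ) ≤ K := by exact_mod_cast hK
  refine div_le_div₀ (by positivity) ?_ (by positivity) (mul_le_mul ?_ ?_ (by positivity)
    (by positivity))
  · exact_mod_cast one_le_mul hS hL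
  · exact_mod_cast hchoose
  · calc ((m : ℝ) / ((k * n).choose 2 : ℕ) * (k * n : ℕ)) ^ (k * n - 1) / (k * n : ℕ)
        ≤ ((m : ℝ) / ((k * n).choose 2 : ℕ) * (k * n : ℕ)) ^ (k * n - 1) :=
          div_le_self (by positivity) hN1
      _ ≤ (1 * (K : ℝ)) ^ (k * n - 1) := by gcongr
      _ ≤ (K : ℝ) ^ K := by
          rw [one_mul]
          exact pow_le_pow_right₀ (hN1.trans hKN) (by omega)

theorem eventually_two_mul_le {k : ℕ} (hk : 2 ≤ k) {c : ℝ} (hc : 0 < c) :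
    ∀ᶠ n : ℕ in atTop, ∀ m : ℕ,
      c * (((k * n).choose 2 : ℝ) / Real.log n) ≤ m → 2 * (k * n - 1 - 1) ≤ m := by
  have hlog : ∀ᶠ n : ℕ in atTop, 4 * Real.log n ≤ c * n := by
    filter_upwards [tendsto_natCast_atTop_atTop.eventually
      (Real.isLittleO_log_id_atTop.bound (show 0 < c / 4 by positivity))] with n hn
    have := (Real.le_norm_self _).trans hn
    rw [id, Real.norm_of_nonneg (Nat.cast_nonneg n)] at this
    linarith
  filter_upwards [hlog, eventually_ge_atTop 2] with n hn hn2 m hm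
  have hn2' : (2 : ℝ) ≤ n := by exact_mod_cast hn2
  have hk2' : (2 : ℝ) ≤ k := by exact_mod_cast hk
  have hlog0 : 0 < Real.log n := Real.log_pos (by linarith)
  rw [← mul_div_assoc, div_le_iff₀ hlog0, Nat.cast_choose_two, Nat.cast_mul] at hm
  have h : 2 * (k * n : ℝ) ≤ m := by
    refine le_of_mul_le_mul_right (le_trans ?_ hm) hlog0
    have h1 : 4 * Real.log n ≤ c * (k * n - 1) :=
      hn.trans (mul_le_mul_of_nonneg_left (by nlinarith) hc.le)
    have h2 := mul_le_mul_of_nonneg_left h1 (by positivity : (0 : ℝ) ≤ k * n)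
    linarith
  have : 2 * (k * n) ≤ m := by exact_mod_cast h
  omega

end LowerBound

/-- Let `N = kn` and `m = p·binom(N,2)` with `m ≥ N-1` and
`m = Ω(binom(N,2)/log n)`. For a uniformly random connected graph `G` on `N` labeled
vertices with `m` edges and a uniformly random spanning tree `T` of `G`, the
probability that `T` is `k`-splittable is at least
`C_k · n^((1-k)/2) · p · e^(-(2+o(1))/p)`, where `C_k` depends only on `k`. -/
theorem gnm_splittable_lower_bound (k : ℕ) (hk : 2 ≤ k) (c : ℝ) (hc : 0 < c) :
    ∃ C : ℝ, 0 < C ∧ ∃ ε : ℕ → ℝ, Tendsto ε atTop (nhds 0) ∧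
      ∀ n m : ℕ, 1 ≤ n → k * n - 1 ≤ m → m ≤ (k * n).choose 2 →
        c * (((k * n).choose 2 : ℝ) / Real.log n) ≤ (m : ℝ) →
        ∀ p : ℝ, p = (m : ℝ) / (((k * n).choose 2 : ℕ) : ℝ) →
          gnmSplitProb k n m ≥
            C * (n : ℝ) ^ ((1 - (k : ℝ)) / 2) * p * Real.exp (-(2 + ε n) / p) := by
  obtain ⟨n₀, hn₀⟩ := eventually_atTop.1 (eventually_two_mul_le hk hc)
  set K := k * (n₀ + 1)
  set C₁ : ℝ := ((k * Real.exp 1) ^ k)⁻¹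
  set C₂ : ℝ := ((2 : ℝ) ^ K ^ 2 * (K : ℝ) ^ K)⁻¹
  have hk0 : 0 < k := by omega
  have hK0 : 0 < K := Nat.mul_pos hk0 n₀.succ_pos
  refine ⟨min C₁ C₂, lt_min (by positivity) (by positivity), fun _ => 0, tendsto_const_nhds, ?_⟩
  intro n m hn hm hmM hcm p hp
  have hp0 : 0 ≤ p := by rw [hp]; positivity
  have hp1 : p ≤ 1 := by
    rw [hp]
    exact div_le_one_of_le₀ (by exact_mod_cast hmM) (Nat.cast_nonneg _)
  have hexp : Real.exp (-2 / p) ≤ 1 :=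
    Real.exp_le_one_iff.2 (div_nonpos_of_nonpos_of_nonneg (by norm_num) hp0)
  have hpow : (n : ℝ) ^ ((1 - (k : ℝ)) / 2) ≤ 1 := by
    refine Real.rpow_le_one_of_one_le_of_nonpos (by exact_mod_cast hn) ?_
    have : (2 : ℝ) ≤ k := by exact_mod_cast hk
    linarith
  rw [add_zero, ge_iff_le]
  rcases le_total n₀ n with h | h
  · refine le_trans ?_ (le_gnmSplitProb_of_two_mul_le hk hn hm hmM (hn₀ n h m hcm))
    rw [← hp]
    have hC := min_le_left C₁ C₂
    calc _ ≤ C₁ * (n : ℝ) ^ ((1 - (k : ℝ)) / 2) * 1 * Real.exp (-2 / p) := by gcongr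
      _ = _ := by rw [mul_one]
  · refine le_trans ?_ (inv_le_gnmSplitProb hk hn hm hmM
      (Nat.mul_le_mul_left k (h.trans n₀.le_succ)))
    have hC := min_le_right C₁ C₂
    calc _ ≤ C₂ * 1 * 1 * 1 := by gcongr
      _ = _ := by simp only [mul_one]; rfl
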